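/- Let R be a commutative ring with identity, S a multiplicatively closed subset of R, and I a nonnil ideal of R. If R is nonnil-S-Laskerian, then the quotient ring R/I is an S̄-Laskerian ring, where S̄ = {s + I : s ∈ S}. -/

import Mathlib

variable {R : Type*}

/-- A proper ideal `Q` disjoint from `S` is `S`-primary if there is `s ∈ S` such that
for all `a b`, `a * b ∈ Q` implies `s * a ∈ Q` or `s * b ∈ Q.radical`. -/
def IsSPrimary [CommRing R] (S : Submonoid R) (Q : Ideal R) : Prop :=
  Q ≠ ⊤ ∧ Disjoint (S : Set R) (Q : Set R) ∧
    ∃ s ∈ S, ∀ a b : R, a * b ∈ Q → s * a ∈ Q ∨ s * b ∈ Q.radical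

/-- An ideal is `S`-decomposable if it is a finite intersection of `S`-primary ideals. -/
def IsSDecomposable [CommRing R] (S : Submonoid R) (I : Ideal R) : Prop :=
  ∃ (n : ℕ) (Q : Fin n → Ideal R), 0 < n ∧ (∀ i, IsSPrimary S (Q i)) ∧ I = ⨅ i, Q i

/-- A ring is nonnil-`S`-Laskerian if every nonnil ideal disjoint from `S`
is `S`-decomposable. -/
def NonnilSLaskerian [CommRing R] (S : Submonoid R) : Prop :=
  ∀ I : Ideal R, ¬ I ≤ nilradical R → Disjoint (S : Set R) (I : Set R) →
    IsSDecomposable S I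

/-- A ring is `S`-Laskerian if every proper ideal disjoint from `S` is `S`-decomposable. -/
def SLaskerian [CommRing R] (S : Submonoid R) : Prop :=
  ∀ I : Ideal R, I ≠ ⊤ → Disjoint (S : Set R) (I : Set R) → IsSDecomposable S I

/-- An ideal `I` is `S`-finite if `s • I ⊆ J ⊆ I` for some `s ∈ S` and finitely
generated ideal `J`. -/
def IsSFinite [CommRing R] (S : Submonoid R) (I : Ideal R) : Prop :=
  ∃ s ∈ S, ∃ J : Ideal R, J.FG ∧ J ≤ I ∧ ∀ x ∈ I, s * x ∈ J

/-- A ring is nonnil-`S`-Noetherian if every nonnil ideal is `S`-finite. -/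
def NonnilSNoetherian [CommRing R] (S : Submonoid R) : Prop :=
  ∀ I : Ideal R, ¬ I ≤ nilradical R → IsSFinite S I

theorem IsSPrimary.of_comap {A B : Type*} [CommRing A] [CommRing B] {f : A →+* B}
    (hf : Function.Surjective f) {S : Submonoid A} {P : Ideal B}
    (h : IsSPrimary S (P.comap f)) : IsSPrimary (S.map f.toMonoidHom) P := by
  obtain ⟨hne, hdisj, s, hs, hmul⟩ := h
  refine ⟨fun hP => hne (by rw [hP, Ideal.comap_top]), ?_, f s, ⟨s, hs, rfl⟩, ?_⟩
  · rw [Set.disjoint_left]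
    rintro _ ⟨t, ht, rfl⟩ htP
    exact Set.disjoint_left.mp hdisj ht htP
  · intro a b hab
    obtain ⟨a, rfl⟩ := hf a
    obtain ⟨b, rfl⟩ := hf b
    have := hmul a b (by rwa [Ideal.mem_comap, map_mul])
    rwa [← Ideal.comap_radical, Ideal.mem_comap, Ideal.mem_comap, map_mul, map_mul] at this

theorem IsSDecomposable.of_comap {A B : Type*} [CommRing A] [CommRing B] {f : A →+* B}
    (hf : Function.Surjective f) {S : Submonoid A} {J : Ideal B}
    (h : IsSDecomposable S (J.comap f)) : IsSDecomposable (S.map f.toMonoidHom) J := by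
  obtain ⟨n, Q, hn, hQ, hJ⟩ := h
  have hcomap : ∀ i, ((Q i).map f).comap f = Q i := fun i => by
    rw [Ideal.comap_map_of_surjective f hf, sup_eq_left]
    exact (Ideal.comap_mono bot_le).trans (hJ.trans_le (iInf_le Q i))
  refine ⟨n, fun i => (Q i).map f, hn, fun i => .of_comap hf ((hcomap i).symm ▸ hQ i), ?_⟩
  apply Ideal.comap_injective_of_surjective f hf
  simp only [Ideal.comap_iInf, hcomap, hJ]

/-- If `R` is nonnil-`S`-Laskerian and `I` is a nonnil ideal, then `R/I` is
`S̄`-Laskerian. -/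
theorem quotient_by_nonnil_SLaskerian {R : Type*} [CommRing R] (S : Submonoid R)
    (I : Ideal R) (hI : ¬ I ≤ nilradical R) (h : NonnilSLaskerian S) :
    SLaskerian (S.map (Ideal.Quotient.mk I).toMonoidHom) := by
  intro J _ hJ
  refine .of_comap Ideal.Quotient.mk_surjective (h _ (fun hle => hI (le_trans ?_ hle)) ?_)
  · intro x hx
    rw [Ideal.mem_comap, Ideal.Quotient.eq_zero_iff_mem.mpr hx]
    exact J.zero_mem
  · rw [Set.disjoint_left]
    exact fun s hs hsJ => Set.disjoint_left.mp hJ ⟨s, hs, rfl⟩ hsJ
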